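/- Let p be a prime and k a commutative ring in which p is a nonzerodivisor. Let N : 𝕎 k → 𝕎 k satisfy the norm ghost formula (the 0-th ghost component of N(a) equals the 0-th ghost component of a, and for every n the (n+1)-st ghost component of N(a) equals the p-th power of the n-th ghost component of a). Then for all a ∈ 𝕎 k: N(V(a)) = p^{p-2} · V(V(a^p)), where p^{p-2} ∈ ℕ and V is the Verschiebung (so V∘V is the Verschiebung V_{p²}). -/

import Mathlib

theorem WittVector.ghostMap_injective_of_regular {p : ℕ} [Fact p.Prime] {k : Type*} [CommRing k]
    (hreg : ∀ x : k, (p : k) * x = 0 → x = 0) :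
    Function.Injective (WittVector.ghostMap : WittVector p k → ℕ → k) := by
  have hpow : ∀ (n : ℕ) (x : k), (p : k) ^ n * x = 0 → x = 0 := by
    intro n
    induction n with
    | zero => simp
    | succ n ih =>
      intro x hx
      exact ih x (hreg _ (by rw [← mul_assoc, ← pow_succ', hx]))
  intro x y hxy
  ext n
  induction n using Nat.strong_induction_on with
  | _ n ih =>
    have h := congrFun hxy n
    rw [WittVector.ghostMap_apply, WittVector.ghostMap_apply, WittVector.ghostComponent_apply,
      WittVector.ghostComponent_apply, aeval_wittPolynomial, aeval_wittPolynomial,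
      Finset.sum_range_succ, Finset.sum_range_succ,
      Finset.sum_congr rfl fun i hi => by rw [ih i (Finset.mem_range.mp hi)]] at h
    have h' := add_left_cancel h
    rw [Nat.sub_self, pow_zero, pow_one, pow_one] at h'
    exact sub_eq_zero.mp (hpow n _ (by rw [mul_sub, h', sub_self]))

/-- Norm of a Verschiebung: if `p` is a nonzerodivisor in `k` and `N : 𝕎 k → 𝕎 k`
satisfies the norm ghost formula, then `N (V a) = p^(p-2) • V (V (a ^ p))`. -/
theorem witt_norm_verschiebung (p : ℕ) [hp : Fact p.Prime] (k : Type*) [CommRing k]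
    (hreg : ∀ x : k, (p : k) * x = 0 → x = 0)
    (N : WittVector p k → WittVector p k)
    (hN0 : ∀ a : WittVector p k,
      WittVector.ghostComponent 0 (N a) = WittVector.ghostComponent 0 a)
    (hNS : ∀ (a : WittVector p k) (n : ℕ),
      WittVector.ghostComponent (n + 1) (N a) = WittVector.ghostComponent n a ^ p)
    (a : WittVector p k) :
    N (WittVector.verschiebung a) =
      p ^ (p - 2) • WittVector.verschiebung (WittVector.verschiebung (a ^ p)) := by
  apply WittVector.ghostMap_injective_of_regular hreg
  funext n
  rw [WittVector.ghostMap_apply, WittVector.ghostMap_apply, map_nsmul]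
  rcases n with _ | _ | n
  · rw [hN0, WittVector.ghostComponent_zero_verschiebung,
      WittVector.ghostComponent_zero_verschiebung, smul_zero]
  · rw [hNS, WittVector.ghostComponent_zero_verschiebung, WittVector.ghostComponent_verschiebung,
      WittVector.ghostComponent_zero_verschiebung, mul_zero, smul_zero,
      zero_pow hp.out.ne_zero]
  · simp only [hNS, WittVector.ghostComponent_verschiebung, map_pow, nsmul_eq_mul, Nat.cast_pow]
    rw [mul_pow, ← mul_assoc, ← mul_assoc, mul_assoc ((p : k) ^ (p - 2)), ← sq, ← pow_add,
      Nat.sub_add_cancel hp.out.two_le]
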